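/- Let V be a finite set with a designated root j0 ∈ V and let p : V \ {j0} → V be a parent function. Then the subtour constraints |{ j ∈ S : p(j) ∈ S }| ≤ |S| − 1 hold for every nonempty subset S ⊆ V \ {j0} if and only if the arcs {(p(j), j) : j ≠ j0} form a spanning arborescence rooted at j0, i.e., every node of V is reachable from j0 along these arcs. -/

import Mathlib

/-- The arc relation of a parent function: there is an arc from `a` to `b`
iff `b` is a non-root node whose parent is `a`. -/
def arcRel {V : Type*} (j0 : V) (p : V → V) : V → V → Prop :=
  fun a b => b ≠ j0 ∧ p b = a

/-- A parent function defines a spanning arborescence rooted at `j0` iff every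
node is reachable from `j0` along the arcs `(p j, j)` for `j ≠ j0`. -/
def IsSpanningArborescence {V : Type*} (j0 : V) (p : V → V) : Prop :=
  ∀ v : V, Relation.ReflTransGen (arcRel j0 p) j0 v

theorem Finset.Nonempty.card_filter_le_card_sub_one_iff {α : Type*} {s : Finset α}
    (hs : s.Nonempty) (q : α → Prop) [DecidablePred q] :
    (s.filter q).card ≤ s.card - 1 ↔ ∃ a ∈ s, ¬ q a := by
  rw [Nat.le_sub_one_iff_lt hs.card_pos, (Finset.card_filter_le s q).lt_iff_ne, Ne,
    Finset.card_filter_eq_iff]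
  push Not
  rfl

theorem subtour_constraints_iff_arborescence {V : Type*} [Fintype V] [DecidableEq V]
    (j0 : V) (p : V → V) :
    (∀ S : Finset V, S.Nonempty → j0 ∉ S →
        (S.filter fun j => p j ∈ S).card ≤ S.card - 1)
      ↔ IsSpanningArborescence j0 p := by
  classical
  constructor
  · intro h
    by_contra hna
    obtain ⟨v, hv⟩ := not_forall.mp hna
    let S := Finset.univ.filter fun w => ¬ Relation.ReflTransGen (arcRel j0 p) j0 w
    have hroot : j0 ∉ S := by simp [S, Relation.ReflTransGen.refl]
    have hS : S.Nonempty := ⟨v, by simpa [S] using hv⟩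
    obtain ⟨j, hj, hpj⟩ :=
      (hS.card_filter_le_card_sub_one_iff _).mp (h S hS hroot)
    have hreach : Relation.ReflTransGen (arcRel j0 p) j0 (p j) := by simpa [S] using hpj
    exact (Finset.mem_filter.mp hj).2
      (hreach.tail ⟨fun hj0 => hroot (hj0 ▸ hj), rfl⟩)
  · intro h S hS hroot
    rw [hS.card_filter_le_card_sub_one_iff]
    by_contra! hclosed
    obtain ⟨v, hv⟩ := hS
    have hnot : v ∉ S := by
      clear hv
      induction h v with
      | refl => exact hroot
      | tail _ harc ih => exact fun hc => ih (harc.2 ▸ hclosed _ hc)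
    exact hnot hv
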